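/- Let X ⊂ S^{d-1} be an antipodal s-distance set with s ≥ 4 and |X| ≥ 4·C(d+s-3, s-2) + 2. Then every inner product β ∈ B(X) is a rational number. -/

import Mathlib

open RealInnerProductSpace

open Polynomial in
/-- An irrational real number has multiplicity at most half the degree as a root of a nonzero
rational polynomial. -/
theorem two_mul_rootMultiplicity_le_natDegree_of_irrational {x : ℝ} (hx : Irrational x) :
    ∀ (n : ℕ) (p : ℚ[X]), p ≠ 0 → p.natDegree ≤ n →
      2 * (p.map (algebraMap ℚ ℝ)).rootMultiplicity x ≤ p.natDegree := by
  intro n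
  induction n using Nat.strong_induction_on with
  | _ n ih =>
  intro p hp hpn
  by_cases hroot : aeval x p = 0
  · have hint : IsIntegral ℚ x := isAlgebraic_iff_isIntegral.mp ⟨p, hp, hroot⟩
    obtain ⟨r, rfl⟩ := minpoly.dvd ℚ x hroot
    have hm0 : minpoly ℚ x ≠ 0 := left_ne_zero_of_mul hp
    have hr0 : r ≠ 0 := right_ne_zero_of_mul hp
    have hdeg : 2 ≤ (minpoly ℚ x).natDegree := by
      have h1 : (minpoly ℚ x).natDegree ≠ 1 := by
        rw [Ne, minpoly.natDegree_eq_one_iff]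
        rintro ⟨q, hq⟩
        exact hx ⟨q, by simpa using hq⟩
      have := minpoly.natDegree_pos hint
      omega
    have hsep : ((minpoly ℚ x).map (algebraMap ℚ ℝ)).Separable :=
      (minpoly.irreducible hint).separable.map
    have hle := rootMultiplicity_le_one_of_separable hsep x
    rw [natDegree_mul hm0 hr0] at hpn ⊢
    have := ih r.natDegree (by omega) r hr0 le_rfl
    rw [Polynomial.map_mul, rootMultiplicity_mul (by
      rw [← Polynomial.map_mul]
      exact (Polynomial.map_ne_zero_iff (algebraMap ℚ ℝ).injective).mpr hp)]
    omega
  · rw [rootMultiplicity_eq_zero (by simpa [IsRoot, eval_map_algebraMap] using hroot)]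
    simp

/-- If a rational matrix becomes a matrix of rank less than half its size after adding the scalar
`K` on the diagonal, then `K` is rational. -/
theorem exists_rat_of_two_mul_rank_lt {n : Type*} [Fintype n] [DecidableEq n]
    (A : Matrix n n ℚ) (K : ℝ)
    (h : 2 * (Matrix.scalar n K + A.map (algebraMap ℚ ℝ)).rank < Fintype.card n) :
    ∃ q : ℚ, K = q := by
  by_contra hK
  have hirr : Irrational K := fun ⟨q, hq⟩ => hK ⟨q, hq.symm⟩
  have hdeg := two_mul_rootMultiplicity_le_natDegree_of_irrational hirr _ (-A).charpoly
    (-A).charpoly_monic.ne_zero le_rfl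
  rw [Matrix.charpoly_natDegree_eq_dim, ← Matrix.charpoly_map] at hdeg
  have heig := LinearMap.finrank_eigenspace_le
    (Matrix.toLin' ((-A).map (algebraMap ℚ ℝ))) K
  rw [Matrix.charpoly_toLin', Module.End.eigenspace_def] at heig
  have hrn := (Matrix.toLin' (Matrix.scalar n K + A.map (algebraMap ℚ ℝ))).finrank_range_add_finrank_ker
  have hker : LinearMap.ker (Matrix.toLin' (Matrix.scalar n K + A.map (algebraMap ℚ ℝ))) =
      LinearMap.ker (Matrix.toLin' ((-A).map (algebraMap ℚ ℝ)) -
        K • 1) := by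
    rw [← LinearMap.ker_neg]
    congr 1
    ext i j
    simp [Matrix.scalar_apply, Matrix.map_apply,
      Pi.single_apply]
    ring
  rw [hker] at hrn
  rw [Matrix.rank, ← Matrix.toLin'_apply'] at h
  simp only [Module.finrank_fintype_fun_eq_card] at hrn
  omega

/-- The space of restrictions to a family `v` of vectors of the homogeneous polynomials of
degree `m`. -/
noncomputable def homogeneousRestriction {ι κ : Type*} (v : ι → κ → ℝ) (m : ℕ) : Submodule ℝ (ι → ℝ) :=
  (MvPolynomial.homogeneousSubmodule κ ℝ m).map
    (LinearMap.pi fun i => (MvPolynomial.aeval (v i)).toLinearMap)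

namespace homogeneousRestriction

variable {ι κ : Type*} {v : ι → κ → ℝ}

theorem mul_mem {a b : ℕ} {f g : ι → ℝ} (hf : f ∈ homogeneousRestriction v a)
    (hg : g ∈ homogeneousRestriction v b) : f * g ∈ homogeneousRestriction v (a + b) := by
  obtain ⟨p, hp, rfl⟩ := hf
  obtain ⟨q, hq, rfl⟩ := hg
  exact ⟨p * q, MvPolynomial.IsHomogeneous.mul hp hq, by ext i; simp⟩

theorem one_mem : 1 ∈ homogeneousRestriction v 0 :=
  ⟨1, MvPolynomial.isHomogeneous_one κ ℝ, by ext i; simp⟩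

theorem pow_mem {a : ℕ} {f : ι → ℝ} (hf : f ∈ homogeneousRestriction v a) (k : ℕ) :
    f ^ k ∈ homogeneousRestriction v (k * a) := by
  induction k with
  | zero => simpa using one_mem
  | succ k ih => rw [pow_succ, add_one_mul]; exact mul_mem ih hf

theorem prod_mem {α : Type*} (s : Finset α) {a : ℕ} {f : α → ι → ℝ}
    (hf : ∀ i ∈ s, f i ∈ homogeneousRestriction v a) :
    ∏ i ∈ s, f i ∈ homogeneousRestriction v (s.card * a) := by
  classical
  induction s using Finset.induction_on with
  | empty => simpa using one_mem
  | insert i s hi ih =>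
    rw [Finset.prod_insert hi, Finset.card_insert_of_notMem hi, add_one_mul, add_comm (_ * _)]
    exact mul_mem (hf i (by simp)) (ih fun j hj => hf j (by simp [hj]))

theorem dotProduct_mem [Fintype κ] (w : κ → ℝ) :
    (fun i => ∑ k, w k * v i k) ∈ homogeneousRestriction v 1 := by
  refine ⟨∑ k, MvPolynomial.C (w k) * MvPolynomial.X k, ?_, by ext i; simp⟩
  exact MvPolynomial.IsHomogeneous.sum _ _ _ fun k _ => by
    simpa using (MvPolynomial.isHomogeneous_C κ (w k)).mul (MvPolynomial.isHomogeneous_X ℝ k)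

theorem normSq_mem [Fintype κ] :
    (fun i => ∑ k, v i k ^ 2) ∈ homogeneousRestriction v 2 := by
  refine ⟨∑ k, MvPolynomial.X k ^ 2, ?_, by ext i; simp⟩
  exact MvPolynomial.IsHomogeneous.sum _ _ _ fun k _ => by
    simpa using (MvPolynomial.isHomogeneous_X ℝ k).pow 2

theorem finrank_le [Fintype κ] [Finite ι] (m : ℕ) :
    Module.finrank ℝ (homogeneousRestriction v m) ≤ (Fintype.card κ + m - 1).choose m := by
  classical
  let mon : Sym κ m → (ι → ℝ) := fun σ i => ((σ : Multiset κ).map (v i)).prod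
  have hle : homogeneousRestriction v m ≤ Submodule.span ℝ (Set.range mon) := by
    rintro _ ⟨p, hp, rfl⟩
    have hsum : (LinearMap.pi fun i => (MvPolynomial.aeval (v i)).toLinearMap) p =
        ∑ e ∈ p.support, p.coeff e • (fun i => (e.toMultiset.map (v i)).prod) := by
      ext i
      simp only [MvPolynomial.aeval_def, MvPolynomial.eval₂_eq, Finsupp.toMultiset_map,
        Finsupp.prod_toMultiset, Finset.sum_apply, LinearMap.pi_apply, AlgHom.toLinearMap_apply,
        Pi.smul_apply, smul_eq_mul, Algebra.algebraMap_self, RingHom.id_apply]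
      refine Finset.sum_congr rfl fun e _ => ?_
      rw [Finsupp.prod_mapDomain_index (by simp) (fun _ _ _ => pow_add _ _ _), Finsupp.prod]
    rw [hsum]
    refine Submodule.sum_mem _ fun e he => Submodule.smul_mem _ _ (Submodule.subset_span ?_)
    refine ⟨⟨e.toMultiset, ?_⟩, rfl⟩
    have := hp (MvPolynomial.mem_support_iff.mp he)
    rw [Finsupp.card_toMultiset, ← this, Finsupp.weight_apply]
    simp [Finsupp.sum]
  calc _ ≤ Module.finrank ℝ (Submodule.span ℝ (Set.range mon)) := Submodule.finrank_mono hle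
    _ ≤ Fintype.card (Sym κ m) := finrank_range_le_card mon
    _ = _ := Sym.card_sym_eq_choose m

end homogeneousRestriction

/-- A matrix whose rows restrict homogeneous polynomials of degree `m` in `d` variables has rank
at most the dimension of the space of those polynomials. -/
theorem rank_le_of_mem_homogeneousRestriction {ι κ : Type*} [Fintype ι] [Fintype κ]
    {v : ι → κ → ℝ} {m : ℕ} (M : Matrix ι ι ℝ) (hM : ∀ i, M i ∈ homogeneousRestriction v m) :
    M.rank ≤ (Fintype.card κ + m - 1).choose m := by
  rw [Matrix.rank_eq_finrank_span_row]
  refine (Submodule.finrank_mono (t := homogeneousRestriction v m) ?_).trans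
    (homogeneousRestriction.finrank_le m)
  rw [Submodule.span_le]
  rintro _ ⟨i, rfl⟩
  exact hM i

/-- An antipodal finite set avoiding zero contains one point of each antipodal pair. -/
theorem exists_half_of_antipodal {E : Type*} [AddCommGroup E] [DecidableEq E] (X : Finset E)
    (hneg : ∀ x ∈ X, -x ∈ X) (hne : ∀ x ∈ X, -x ≠ x) :
    ∃ Y ⊆ X, (∀ x ∈ Y, -x ∉ Y) ∧ X.card ≤ 2 * Y.card := by
  classical
  let Y := X.filter fun x => WellOrderingRel x (-x)
  refine ⟨Y, Finset.filter_subset _ _, fun x hx hx' => ?_, ?_⟩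
  · have h1 := (Finset.mem_filter.mp hx).2
    have h2 := (Finset.mem_filter.mp hx').2
    rw [neg_neg] at h2
    exact asymm_of WellOrderingRel h1 h2
  · have hsub : X ⊆ Y ∪ Y.image Neg.neg := by
      intro x hx
      rcases trichotomous_of WellOrderingRel x (-x) with h | h | h
      · exact Finset.mem_union_left _ (Finset.mem_filter.mpr ⟨hx, h⟩)
      · exact absurd h.symm (hne x hx)
      · refine Finset.mem_union_right _ (Finset.mem_image.mpr ⟨-x, ?_, neg_neg x⟩)
        exact Finset.mem_filter.mpr ⟨hneg x hx, by rwa [neg_neg]⟩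
    have h1 := Finset.card_le_card hsub
    have h2 := Finset.card_union_le Y (Y.image Neg.neg)
    have h3 := Finset.card_image_le (s := Y) (f := Neg.neg)
    omega

/-- The characteristic expression attached to the absolute inner product `β` of a large family of
unit vectors whose nonzero absolute inner products lie in `P` is rational. -/
theorem exists_rat_prod_div_pow {d : ℕ} {Y : Finset (EuclideanSpace ℝ (Fin d))}
    (hunit : ∀ x ∈ Y, ‖x‖ = 1) {P : Finset ℝ} (hpos : ∀ b ∈ P, 0 < b) {β : ℝ} (hβ : β ∈ P)
    {e : ℕ} (hY : ∀ x ∈ Y, ∀ y ∈ Y, x ≠ y → |⟪x, y⟫| ∈ P ∨ e ≠ 0 ∧ ⟪x, y⟫ = 0) {m : ℕ}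
    (hm : m = e + (P.erase β).card * 2) (hcard : 2 * (d + m - 1).choose m < Y.card) :
    ∃ q : ℚ, (β⁻¹) ^ e * ∏ b ∈ P.erase β, (1 - b ^ 2) / (β ^ 2 - b ^ 2) = q := by
  classical
  let f : ℝ → ℝ := fun u => (β⁻¹ * u) ^ e * ∏ b ∈ P.erase β, (u ^ 2 - b ^ 2) / (β ^ 2 - b ^ 2)
  have hβ0 : β ≠ 0 := (hpos β hβ).ne'
  have hval : ∀ x ∈ Y, ∀ y ∈ Y, x ≠ y → ∃ q : ℚ, f ⟪x, y⟫ = q := by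
    intro x hx y hy hxy
    rcases hY x hx y hy hxy with h | ⟨he, h⟩
    · by_cases hb : |⟪x, y⟫| = β
      · have hprod : ∏ b ∈ P.erase β, (⟪x, y⟫ ^ 2 - b ^ 2) / (β ^ 2 - b ^ 2) = 1 := by
          refine Finset.prod_eq_one fun b hbP => ?_
          rw [← sq_abs, hb]
          refine div_self (sub_ne_zero.mpr fun hsq => Finset.ne_of_mem_erase hbP ?_)
          exact ((pow_left_inj₀ (hpos β hβ).le (hpos b (Finset.mem_of_mem_erase hbP)).le
            two_ne_zero).mp hsq).symm
        rcases eq_or_eq_neg_of_abs_eq hb with h1 | h1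
        · exact ⟨1, by simp only [f]; rw [hprod, h1]; simp [hβ0]⟩
        · exact ⟨(-1) ^ e, by simp only [f]; rw [hprod, h1]; simp [hβ0]⟩
      · refine ⟨0, ?_⟩
        simp only [f]
        rw [Finset.prod_eq_zero (Finset.mem_erase.mpr ⟨hb, h⟩) (by simp [sq_abs])]
        simp
    · exact ⟨0, by simp [f, h, he]⟩
  have hoff : ∀ x y : Y, ∃ q : ℚ, x ≠ y → f ⟪x.1, y.1⟫ = q := fun x y => by
    by_cases hxy : x = y
    · exact ⟨0, fun h => absurd hxy h⟩
    · obtain ⟨q, hq⟩ := hval x x.2 y y.2 fun h => hxy (Subtype.ext h)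
      exact ⟨q, fun _ => hq⟩
  choose A hA using hoff
  let v : Y → Fin d → ℝ := fun y => y.1
  have hone : (1 : Y → ℝ) ∈ homogeneousRestriction v 2 := by
    convert! homogeneousRestriction.normSq_mem (v := v) using 1
    ext y
    have := EuclideanSpace.real_norm_sq_eq y.1
    rw [hunit y y.2] at this
    simpa using this
  let M : Matrix Y Y ℝ := fun x y => f ⟪x.1, y.1⟫
  have hM : ∀ x, M x ∈ homogeneousRestriction v m := by
    intro x
    let g : Y → ℝ := fun y => ⟪x.1, y.1⟫
    have hg : g ∈ homogeneousRestriction v 1 := by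
      convert! homogeneousRestriction.dotProduct_mem (v := v) (x.1 : Fin d → ℝ) using 1
      ext y
      simp [g, v, PiLp.inner_apply, mul_comm]
    have hmem := homogeneousRestriction.mul_mem
      (homogeneousRestriction.pow_mem (Submodule.smul_mem _ β⁻¹ hg) e)
      (homogeneousRestriction.prod_mem (P.erase β)
        (f := fun b => (β ^ 2 - b ^ 2)⁻¹ • (g ^ 2 - b ^ 2 • (1 : Y → ℝ)))
        fun b _ => Submodule.smul_mem _ _ (Submodule.sub_mem _
          (homogeneousRestriction.pow_mem hg 2) (Submodule.smul_mem _ _ hone)))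
    rw [mul_one, ← hm] at hmem
    convert! hmem using 1
    ext y
    simp [M, f, g, Finset.prod_apply, div_eq_inv_mul]
  have hrank := rank_le_of_mem_homogeneousRestriction M hM
  rw [Fintype.card_fin] at hrank
  refine exists_rat_of_two_mul_rank_lt (Matrix.of fun x y => if x = y then 0 else A x y) _ ?_
  convert! (Nat.mul_le_mul_left 2 hrank).trans_lt hcard using 1
  · congr 2
    ext x y
    by_cases hxy : x = y
    · subst hxy
      simp [M, f, hunit x x.2]
    · simp [M, hxy, hA x y hxy]
  · exact Fintype.card_coe Y

theorem antipodal_inner_products_rational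
    (d s : ℕ) (hs : 4 ≤ s)
    (X : Finset (EuclideanSpace ℝ (Fin d)))
    (hsphere : ∀ x ∈ X, ‖x‖ = 1)
    (hantip : ∀ x ∈ X, -x ∈ X)
    (hsdist : {r : ℝ | ∃ x ∈ X, ∃ y ∈ X, x ≠ y ∧ ⟪x, y⟫ = r}.ncard = s)
    (hcard : 4 * Nat.choose (d + s - 3) (s - 2) + 2 ≤ X.card) :
    ∀ r ∈ {r : ℝ | ∃ x ∈ X, ∃ y ∈ X, x ≠ y ∧ ⟪x, y⟫ = r}, ∃ q : ℚ, r = (q : ℝ) := by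
  classical
  set B := {r : ℝ | ∃ x ∈ X, ∃ y ∈ X, x ≠ y ∧ ⟪x, y⟫ = r} with hB
  have hfin : B.Finite := Set.finite_of_ncard_ne_zero (by omega)
  have hlt : ∀ r ∈ B, r < 1 := by
    rintro r ⟨x, hx, y, hy, hxy, rfl⟩
    exact (inner_lt_one_iff_real_of_norm_eq_one (hsphere x hx) (hsphere y hy)).mpr hxy
  have hnegB : ∀ r ∈ B, r ≠ -1 → -r ∈ B := by
    rintro r ⟨x, hx, y, hy, hxy, rfl⟩ hr
    refine ⟨x, hx, -y, hantip y hy, ?_, inner_neg_right x y⟩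
    rintro h
    apply hr
    rw [← neg_eq_iff_eq_neg.mpr h, inner_neg_right, real_inner_self_eq_norm_sq, hsphere x hx]
    norm_num
  have hX0 : ∀ x ∈ X, -x ≠ x := by
    intro x hx h
    have h1 := hsphere x hx
    have h2 := (inner_eq_neg_one_iff_of_norm_eq_one (𝕜 := ℝ) h1 h1).mpr h.symm
    rw [real_inner_self_eq_norm_sq, h1] at h2
    norm_num at h2
  obtain ⟨Y, hYX, hYneg, hYcard⟩ := exists_half_of_antipodal X hantip hX0
  obtain ⟨x₀, hx₀⟩ : X.Nonempty := Finset.card_pos.mp (by omega)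
  have hneg1 : (-1 : ℝ) ∈ B := ⟨x₀, hx₀, -x₀, hantip x₀ hx₀, (hX0 x₀ hx₀).symm, by
    rw [inner_neg_right, real_inner_self_eq_norm_sq, hsphere x₀ hx₀]; norm_num⟩
  set P := hfin.toFinset.filter (0 < ·) with hP
  set Z := hfin.toFinset.filter (0 = ·) with hZ
  have memP : ∀ b, b ∈ P ↔ b ∈ B ∧ 0 < b := by simp [hP]
  have hpos : ∀ b ∈ P, 0 < b := fun b hb => ((memP b).mp hb).2
  have hYP : ∀ x ∈ Y, ∀ y ∈ Y, x ≠ y → |⟪x, y⟫| ∈ P ∨ 0 ∈ B ∧ ⟪x, y⟫ = 0 := by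
    intro x hx y hy hxy
    have hmem : ⟪x, y⟫ ∈ B := ⟨x, hYX hx, y, hYX hy, hxy, rfl⟩
    have hne : ⟪x, y⟫ ≠ -1 := fun h => by
      rw [inner_eq_neg_one_iff_of_norm_eq_one (hsphere x (hYX hx)) (hsphere y (hYX hy))] at h
      exact hYneg y hy (h ▸ hx)
    rcases lt_trichotomy ⟪x, y⟫ 0 with h | h | h
    · left
      rw [abs_of_neg h, memP]
      exact ⟨hnegB _ hmem hne, by linarith⟩
    · exact Or.inr ⟨h ▸ hmem, h⟩
    · left
      rw [abs_of_pos h, memP]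
      exact ⟨hmem, h⟩
  have hcount : s = 1 + 2 * P.card + Z.card := by
    have hset : hfin.toFinset = {-1} ∪ (P ∪ P.image Neg.neg) ∪ Z := by
      ext r
      simp only [Set.Finite.mem_toFinset, Finset.mem_union, Finset.mem_singleton,
        Finset.mem_image, memP, hZ, Finset.mem_filter]
      constructor
      · intro hr
        by_cases h1 : r = -1
        · exact Or.inl (Or.inl h1)
        rcases lt_trichotomy r 0 with h | h | h
        · exact Or.inl (Or.inr (Or.inr ⟨-r, ⟨hnegB r hr h1, by linarith⟩, neg_neg r⟩))
        · exact Or.inr ⟨hr, h.symm⟩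
        · exact Or.inl (Or.inr (Or.inl ⟨hr, h⟩))
      · rintro ((rfl | h | ⟨b, ⟨hb, hb0⟩, rfl⟩) | h)
        · exact hneg1
        · exact h.1
        · exact hnegB b hb (by linarith)
        · exact h.1
    have h1 : Disjoint ({-1} ∪ (P ∪ P.image Neg.neg)) Z := by
      rw [Finset.disjoint_left]
      simp only [hZ, Finset.mem_filter, Finset.mem_union, Finset.mem_singleton, Finset.mem_image,
        memP]
      rintro r (rfl | h | ⟨b, hb, rfl⟩) ⟨-, h0⟩ <;> linarith
    have h2 : Disjoint {-1} (P ∪ P.image Neg.neg) := by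
      rw [Finset.disjoint_left]
      simp only [Finset.mem_union, Finset.mem_singleton, Finset.mem_image, memP]
      rintro r rfl (h | ⟨b, hb, h⟩)
      · linarith
      · have := hlt b hb.1
        linarith
    have h3 : Disjoint P (P.image Neg.neg) := by
      rw [Finset.disjoint_left]
      simp only [Finset.mem_image, memP]
      rintro r hr ⟨b, hb, h⟩
      linarith
    rw [← hsdist, Set.ncard_eq_toFinset_card B hfin, hset, Finset.card_union_of_disjoint h1,
      Finset.card_union_of_disjoint h2, Finset.card_union_of_disjoint h3,
      Finset.card_image_of_injective _ neg_injective, Finset.card_singleton]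
    ring
  have hrat : ∀ β ∈ P, ∃ q : ℚ, β = q := by
    intro β hβ
    obtain ⟨e, he, hB0⟩ : ∃ e, e = Z.card ∧ (0 ∈ B → e ≠ 0) := by
      refine ⟨_, rfl, fun h => (Finset.card_pos.mpr ⟨0, ?_⟩).ne'⟩
      simpa [hZ] using h
    have hPc : (P.erase β).card + 1 = P.card := Finset.card_erase_add_one hβ
    have hchoose : (d + (s - 3) - 1).choose (s - 3) ≤ (d + (s - 2) - 1).choose (s - 2) := by
      have e1 : d + (s - 2) - 1 = (d + (s - 3) - 1) + 1 := by omega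
      have e2 : s - 2 = (s - 3) + 1 := by omega
      rw [e1, e2, Nat.choose_succ_succ]
      omega
    have e3 : d + (s - 2) - 1 = d + s - 3 := by omega
    rw [e3] at hchoose
    obtain ⟨q₁, h₁⟩ := exists_rat_prod_div_pow (fun x hx => hsphere x (hYX hx)) hpos hβ (e := e)
      (fun x hx y hy hxy => (hYP x hx y hy hxy).imp_right fun h => ⟨hB0 h.1, h.2⟩)
      (m := s - 3) (by omega) (by omega)
    obtain ⟨q₂, h₂⟩ := exists_rat_prod_div_pow (fun x hx => hsphere x (hYX hx)) hpos hβ (e := e + 1)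
      (fun x hx y hy hxy => (hYP x hx y hy hxy).imp_right fun h => ⟨e.succ_ne_zero, h.2⟩)
      (m := s - 2) (by omega) (by rw [e3]; omega)
    have hβ0 : β ≠ 0 := (hpos β hβ).ne'
    have hne : (q₁ : ℝ) ≠ 0 := by
      rw [← h₁]
      refine mul_ne_zero (pow_ne_zero _ (inv_ne_zero hβ0)) (Finset.prod_ne_zero_iff.mpr ?_)
      intro b hb
      have hbP := Finset.mem_of_mem_erase hb
      have hb0 := hpos b hbP
      have hb1 := hlt b ((memP b).mp hbP).1
      refine div_ne_zero (by nlinarith) (sub_ne_zero.mpr fun hsq => Finset.ne_of_mem_erase hb ?_)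
      exact ((pow_left_inj₀ (hpos β hβ).le hb0.le two_ne_zero).mp hsq).symm
    have hq : (q₂ : ℝ) = β⁻¹ * q₁ := by
      rw [← h₁, ← h₂]
      ring
    refine ⟨q₁ / q₂, ?_⟩
    push_cast
    rw [hq]
    field_simp
  intro r hr
  by_cases h1 : r = -1
  · exact ⟨-1, by simp [h1]⟩
  rcases lt_trichotomy r 0 with h | h | h
  · obtain ⟨q, hq⟩ := hrat (-r) ((memP _).mpr ⟨hnegB r hr h1, by linarith⟩)
    exact ⟨-q, by push_cast; linarith⟩
  · exact ⟨0, by simp [h]⟩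
  · exact hrat r ((memP _).mpr ⟨hr, h⟩)
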